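/- Fix a lexicographic order ≼ on the free group F = Fₘ (m ≥ 1 generators). Then for every ν ∈ F̂ the graph Γ_ν is chordal. -/

import Mathlib

namespace FreeGroupLex

variable {m : ℕ}

/-- The length of the longest common prefix of two lists. -/
def commonPrefixLen {α : Type*} [DecidableEq α] : List α → List α → ℕ
  | a :: as, b :: bs => if a = b then commonPrefixLen as bs + 1 else 0
  | _, _ => 0

/-- A strict total order `lt` on the free group `Fₘ` is *lexicographic* if:
(1) shorter (reduced) words come first; (2) words of equal length are compared by the
first letter (an element of `A ∪ A⁻¹`, i.e. a one-letter word) at which their reduced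
words differ. -/
def IsLexOrder (lt : FreeGroup (Fin m) → FreeGroup (Fin m) → Prop) : Prop :=
  IsStrictTotalOrder (FreeGroup (Fin m)) lt ∧
  (∀ s t : FreeGroup (Fin m), FreeGroup.norm s < FreeGroup.norm t → lt s t) ∧
  (∀ s t : FreeGroup (Fin m), FreeGroup.norm s = FreeGroup.norm t → s ≠ t →
    ∀ a b : Fin m × Bool,
      s.toWord[commonPrefixLen s.toWord t.toWord]? = some a →
      t.toWord[commonPrefixLen s.toWord t.toWord]? = some b →
      (lt s t ↔ lt (FreeGroup.mk [a]) (FreeGroup.mk [b])))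

/-- The induced order on `F̂ = F/{s ∼ s⁻¹}`: the class of `x` is `≼` the class of `y`
iff `min {x, x⁻¹} ≼ min {y, y⁻¹}`, written without choice via
`min {x,x⁻¹} ≼ min {y,y⁻¹} ↔ (x ≼ y ∨ x⁻¹ ≼ y) ∧ (x ≼ y⁻¹ ∨ x⁻¹ ≼ y⁻¹)`
(where `u ≼ v` means `lt u v ∨ u = v`). -/
def hatLe (lt : FreeGroup (Fin m) → FreeGroup (Fin m) → Prop)
    (x y : FreeGroup (Fin m)) : Prop :=
  ((lt x y ∨ x = y) ∨ (lt x⁻¹ y ∨ x⁻¹ = y)) ∧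
  ((lt x y⁻¹ ∨ x = y⁻¹) ∨ (lt x⁻¹ y⁻¹ ∨ x⁻¹ = y⁻¹))

/-- Strict version of `hatLe`: the class of `x` is strictly before the class of `y`. -/
def hatLt (lt : FreeGroup (Fin m) → FreeGroup (Fin m) → Prop)
    (x y : FreeGroup (Fin m)) : Prop :=
  hatLe lt x y ∧ ¬ hatLe lt y x

/-- Equality of classes in `F̂`, expressed via `hatLe`. -/
def hatEq (lt : FreeGroup (Fin m) → FreeGroup (Fin m) → Prop)
    (x y : FreeGroup (Fin m)) : Prop :=
  hatLe lt x y ∧ hatLe lt y x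

/-- The graph `Γ_ν` on the vertex set `F`: distinct `s, t` are adjacent iff the class of
`s⁻¹t` is `≼ ν` (the class of `ν`). -/
def Gamma (lt : FreeGroup (Fin m) → FreeGroup (Fin m) → Prop)
    (ν : FreeGroup (Fin m)) : SimpleGraph (FreeGroup (Fin m)) where
  Adj s t := s ≠ t ∧ hatLe lt (s⁻¹ * t) ν
  symm := by
    constructor
    rintro s t ⟨h1, h2⟩
    refine ⟨h1.symm, ?_⟩
    have e : t⁻¹ * s = (s⁻¹ * t)⁻¹ := by group
    rw [e]
    unfold hatLe at h2 ⊢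
    rw [inv_inv]
    tauto
  loopless := by constructor; rintro s ⟨h, -⟩; exact h rfl

/-- A cycle (closed walk) `w` in `G` has a chord if two of its vertices are adjacent in `G`
but the corresponding edge is not an edge of the cycle. -/
def _root_.SimpleGraph.Walk.HasChord {V : Type*} {G : SimpleGraph V} {v : V}
    (w : G.Walk v v) : Prop :=
  ∃ x y : V, x ∈ w.support ∧ y ∈ w.support ∧ G.Adj x y ∧ s(x, y) ∉ w.edges

/-- A simple graph is chordal if every cycle of length at least 4 has a chord. -/
def _root_.SimpleGraph.IsChordalGraph {V : Type*} (G : SimpleGraph V) : Prop :=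
  ∀ (v : V) (w : G.Walk v v), w.IsCycle → 4 ≤ w.length → w.HasChord

section Lists

variable {α : Type*} [DecidableEq α]

theorem cpl_decomp : ∀ l l' : List α, ∃ P A B : List α, l = P ++ A ∧ l' = P ++ B ∧
    commonPrefixLen l l' = P.length ∧ ∀ a ∈ A.head?, ∀ b ∈ B.head?, a ≠ b
  | [], l' => ⟨[], [], l', by simp [commonPrefixLen]⟩
  | a :: l, [] => ⟨[], a :: l, [], by simp [commonPrefixLen]⟩
  | a :: l, b :: l' => by
    by_cases h : a = b
    · obtain ⟨P, A, B, h1, h2, h3, h4⟩ := cpl_decomp l l'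
      subst h
      exact ⟨a :: P, A, B, by simp [h1], by simp [h2], by simp [commonPrefixLen, h3], h4⟩
    · exact ⟨[], a :: l, b :: l', by simp [commonPrefixLen, h]⟩

theorem le_cpl_iff : ∀ (k : ℕ) (l l' : List α), k ≤ commonPrefixLen l l' ↔
    k ≤ l.length ∧ k ≤ l'.length ∧ l.take k = l'.take k
  | 0, l, l' => by simp
  | k + 1, [], l' => by simp [commonPrefixLen]
  | k + 1, a :: l, [] => by simp [commonPrefixLen]
  | k + 1, a :: l, b :: l' => by
    have := le_cpl_iff k l l'
    by_cases h : a = b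
    · simp [commonPrefixLen, h, this]
    · simp [commonPrefixLen, h]

theorem cpl_comm (l l' : List α) : commonPrefixLen l l' = commonPrefixLen l' l := by
  apply le_antisymm
  · obtain ⟨h1, h2, h3⟩ := (le_cpl_iff _ l l').1 le_rfl
    exact (le_cpl_iff _ _ _).2 ⟨h2, h1, h3.symm⟩
  · obtain ⟨h1, h2, h3⟩ := (le_cpl_iff _ l' l).1 le_rfl
    exact (le_cpl_iff _ _ _).2 ⟨h2, h1, h3.symm⟩

theorem cpl_ultra (l l' l'' : List α) (k : ℕ) (h : k ≤ commonPrefixLen l l')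
    (h' : k ≤ commonPrefixLen l' l'') : k ≤ commonPrefixLen l l'' := by
  rw [le_cpl_iff] at *
  exact ⟨h.1, h'.2.1, h.2.2.trans h'.2.2⟩

theorem cpl_le_left (l l' : List α) : commonPrefixLen l l' ≤ l.length :=
  ((le_cpl_iff _ l l').1 le_rfl).1

theorem cpl_le_right (l l' : List α) : commonPrefixLen l l' ≤ l'.length :=
  ((le_cpl_iff _ l l').1 le_rfl).2.1

theorem lex_append : ∀ (A A' B B' : List ℕ), A.length = A'.length →
    (A ++ B < A' ++ B' ↔ A < A' ∨ (A = A' ∧ B < B'))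
  | [], [], B, B', _ => by simp
  | [], _ :: _, _, _, h => by simp at h
  | _ :: _, [], _, _, h => by simp at h
  | a :: A, a' :: A', B, B', h => by
    have := lex_append A A' B B' (by simpa using h)
    simp only [List.cons_append, List.cons_lt_cons_iff, this, List.cons.injEq]
    tauto

theorem lex_take (k : ℕ) (l l' : List ℕ) (h : l.length = l'.length) (hl : l ≤ l') :
    l.take k ≤ l'.take k := by
  rcases hl.lt_or_eq with hl | rfl
  · rw [← List.take_append_drop k l, ← List.take_append_drop k l',
      lex_append _ _ _ _ (by simp [h])] at hl
    rcases hl with hl | hl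
    · exact hl.le
    · exact hl.1.le
  · exact le_rfl

theorem lex_of_take (k : ℕ) (l l' : List ℕ) (h : l.length = l'.length)
    (hl : l.take k < l'.take k) : l < l' := by
  rw [← List.take_append_drop k l, ← List.take_append_drop k l',
      lex_append _ _ _ _ (by simp [h])]
  exact Or.inl hl

end Lists

section Grp

variable {α : Type*} [DecidableEq α]

open FreeGroup

/-- word metric -/
def dist' (s t : FreeGroup α) : ℕ := norm (s⁻¹ * t)

/-- common prefix length for group elements -/
def gp (s t : FreeGroup α) : ℕ := commonPrefixLen s.toWord t.toWord

theorem gp_comm (s t : FreeGroup α) : gp s t = gp t s := cpl_comm _ _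

theorem gp_ultra (s t u : FreeGroup α) (k : ℕ) (h : k ≤ gp s t) (h' : k ≤ gp t u) :
    k ≤ gp s u := cpl_ultra _ _ _ k h h'

theorem gp_le_left (s t : FreeGroup α) : gp s t ≤ norm s := cpl_le_left _ _
theorem gp_le_right (s t : FreeGroup α) : gp s t ≤ norm t := cpl_le_right _ _

theorem dist'_comm (s t : FreeGroup α) : dist' s t = dist' t s := by
  unfold dist'
  rw [← norm_inv_eq]; simp

theorem dist'_left (p s t : FreeGroup α) : dist' (p * s) (p * t) = dist' s t := by
  unfold dist'
  congr 1; group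

theorem dist'_eq_zero (s t : FreeGroup α) : dist' s t = 0 ↔ s = t := by
  unfold dist'
  rw [FreeGroup.norm_eq_zero, inv_mul_eq_one]

theorem isReduced_invRev {L : List (α × Bool)} (h : IsReduced L) : IsReduced (invRev L) := by
  rw [isReduced_iff_reduce_eq] at *
  rw [reduce_invRev, h]

theorem isReduced_glue {A B : List (α × Bool)} (hA : IsReduced A) (hB : IsReduced B)
    (h : ∀ a ∈ A.head?, ∀ b ∈ B.head?, a ≠ b) : IsReduced (invRev A ++ B) := by
  unfold FreeGroup.IsReduced
  rw [List.isChain_append]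
  refine ⟨isReduced_invRev hA, hB, ?_⟩
  intro x hx y hy hxy
  simp only [invRev, List.getLast?_reverse, List.head?_map, Option.mem_def,
    Option.map_eq_some_iff] at hx
  obtain ⟨a, ha, rfl⟩ := hx
  have := h a ha y hy
  rcases a with ⟨a, b⟩
  rcases y with ⟨c, d⟩
  simp only at hxy
  subst hxy
  cases b <;> cases d <;> simp_all

theorem toWord_inv_mul (s t : FreeGroup α) :
    (s⁻¹ * t).toWord = invRev (s.toWord.drop (gp s t)) ++ t.toWord.drop (gp s t) := by
  obtain ⟨P, A, B, h1, h2, h3, h4⟩ := cpl_decomp s.toWord t.toWord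
  have hs : IsReduced (P ++ A) := h1 ▸ isReduced_toWord
  have ht : IsReduced (P ++ B) := h2 ▸ isReduced_toWord
  have hA : IsReduced A := hs.infix (List.suffix_append _ _).isInfix
  have hB : IsReduced B := ht.infix (List.suffix_append _ _).isInfix
  have e : s⁻¹ * t = mk (invRev A ++ B) := by
    rw [← mk_toWord (x := s), ← mk_toWord (x := t), h1, h2, ← mul_mk, ← mul_mk, ← mul_mk, ← inv_mk]
    group
  have hd : gp s t = P.length := h3
  rw [e, toWord_mk, (isReduced_glue hA hB h4).reduce_eq, hd, h1, h2]
  simp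

theorem dist'_eq (s t : FreeGroup α) : dist' s t + 2 * gp s t = norm s + norm t := by
  have h1 := gp_le_left s t
  have h2 := gp_le_right s t
  unfold dist'
  unfold FreeGroup.norm at *
  rw [toWord_inv_mul]
  simp
  omega

theorem toWord_inv_mul' (s t : FreeGroup α) (h : gp s t = 0) :
    (s⁻¹ * t).toWord = invRev s.toWord ++ t.toWord := by
  rw [toWord_inv_mul, h]; simp

/-- prefix of a group element -/
def pre (s : FreeGroup α) (k : ℕ) : FreeGroup α := mk (s.toWord.take k)

theorem toWord_pre (s : FreeGroup α) (k : ℕ) : (pre s k).toWord = s.toWord.take k := by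
  unfold pre
  rw [toWord_mk]
  apply IsReduced.reduce_eq
  exact isReduced_toWord.infix (List.take_prefix _ _).isInfix

theorem norm_pre (s : FreeGroup α) (k : ℕ) (h : k ≤ norm s) : norm (pre s k) = k := by
  unfold FreeGroup.norm at *
  rw [toWord_pre]; simpa using h

theorem gp_pre (s t : FreeGroup α) (k : ℕ) (h : k ≤ norm s) :
    gp (pre s k) t = min k (gp s t) := by
  apply le_antisymm
  · rw [le_min_iff]
    refine ⟨by simpa [norm_pre s k h] using gp_le_left (pre s k) t, ?_⟩
    refine gp_ultra s (pre s k) t _ ?_ le_rfl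
    have h0 := gp_le_left (pre s k) t
    rw [norm_pre s k h] at h0
    refine (le_cpl_iff _ _ _).2 ⟨h0.trans h, gp_le_left _ _, ?_⟩
    rw [toWord_pre, List.take_take, min_eq_left h0]
  · refine gp_ultra (pre s k) s t _ ?_ (min_le_right _ _)
    refine (le_cpl_iff _ _ _).2 ⟨?_, (min_le_left _ _).trans h, ?_⟩
    · have := norm_pre s k h
      unfold FreeGroup.norm at this
      omega
    · rw [toWord_pre, List.take_take, min_eq_left (min_le_left _ _)]

/-- A nontrivial element and its inverse cannot share half of their letters. -/
theorem no_half (g : FreeGroup α) (k : ℕ) (hk : norm g ≤ 2 * k)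
    (h : g.toWord.take k = g⁻¹.toWord.take k) : g = 1 := by
  have key : ∀ j, norm g ≤ 2 * j → norm g + 1 ≥ 2 * j → g.toWord.take j = g⁻¹.toWord.take j →
      g = 1 := by
    intro j h1 h2 h3
    rw [toWord_inv] at h3
    unfold FreeGroup.norm at h1 h2
    generalize hl : g.toWord = l at *
    rcases Nat.lt_or_ge l.length (2 * j) with h4 | h4
    · obtain ⟨i, rfl⟩ : ∃ i, j = i + 1 := ⟨j - 1, by omega⟩
      have hi : l.length = 2 * i + 1 := by omega
      have e1 : l = l.take i ++ (l[i] :: l.drop (i + 1)) := by simp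
      have e2 := congrArg (fun L => L[i]?) h3
      have h5 : l.length - 1 - i = i := by omega
      have h6 : i < l.length := by omega
      simp [invRev, h6] at e2
      have := congrArg Prod.snd e2
      simp [h5] at this
    · have e : l = l.take j ++ l.drop j := by simp
      have e2 : invRev l = invRev (l.drop j) ++ invRev (l.take j) := by
        rw [← invRev_append, ← e]
      rw [e2, List.take_append_of_le_length (by rw [invRev_length, List.length_drop]; omega),
        List.take_of_length_le (l := invRev (l.drop j))
          (by rw [invRev_length, List.length_drop]; omega)] at h3
      have e3 : l = invRev (l.drop j) ++ l.drop j := by rw [← h3]; exact e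
      have e4 : mk (invRev (l.drop j) ++ l.drop j) = 1 := by
        rw [← mul_mk, ← inv_mk, inv_mul_cancel]
      rw [← mk_toWord (x := g), hl, e3, e4]
  set j := (norm g + 1) / 2 with hj
  apply key j (by omega) (by omega)
  have := congrArg (List.take j) h
  rwa [List.take_take, List.take_take, min_eq_left (by omega)] at this

end Grp

section Core

variable {α : Type*} [DecidableEq α]

/-- ranked word -/
def W (e : α × Bool → ℕ) (g : FreeGroup α) : List ℕ := g.toWord.map e

/-- Abstract properties of the graphs under consideration. -/
structure Good (e : α × Bool → ℕ) (M : List ℕ) (n : ℕ) (G : SimpleGraph (FreeGroup α)) : Prop where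
  inj : Function.Injective e
  len : M.length = n
  le : ∀ s t, G.Adj s t → dist' s t ≤ n
  lt : ∀ s t, s ≠ t → dist' s t < n → G.Adj s t
  eq : ∀ s t, s ≠ t → dist' s t = n → (G.Adj s t ↔ W e (s⁻¹ * t) ≤ M ∨ W e (t⁻¹ * s) ≤ M)
  inv : ∀ p s t, G.Adj (p * s) (p * t) ↔ G.Adj s t

/-- Chordless cycle. -/
structure Hole {V : Type*} (G : SimpleGraph V) (q : ℕ) (F : ℕ → V) : Prop where
  four : 4 ≤ q
  inj : ∀ i j, i < q → j < q → F i = F j → i = j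
  adj : ∀ i j, i < q → j < q → (G.Adj (F i) (F j) ↔
    (j = i + 1 ∨ i = j + 1 ∨ (i = 0 ∧ j + 1 = q) ∨ (j = 0 ∧ i + 1 = q)))

theorem Hole.rotate {V : Type*} {G : SimpleGraph V} {q : ℕ} {F : ℕ → V} (H : Hole G q F)
    (a : ℕ) (ha : a < q) : Hole G q (fun k => F (if k + a < q then k + a else k + a - q)) := by
  have h4 := H.four
  refine ⟨H.four, ?_, ?_⟩
  · intro i j hi hj h
    have := H.inj _ _ (by split_ifs <;> omega) (by split_ifs <;> omega) h
    split_ifs at this <;> omega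
  · intro i j hi hj
    rw [H.adj _ _ (by split_ifs <;> omega) (by split_ifs <;> omega)]
    split_ifs <;> omega

theorem Hole.reflect {V : Type*} {G : SimpleGraph V} {q : ℕ} {F : ℕ → V} (H : Hole G q F) :
    Hole G q (fun k => F (if k = 0 then 0 else q - k)) := by
  have h4 := H.four
  refine ⟨H.four, ?_, ?_⟩
  · intro i j hi hj h
    have := H.inj _ _ (by split_ifs <;> omega) (by split_ifs <;> omega) h
    split_ifs at this <;> omega
  · intro i j hi hj
    rw [H.adj _ _ (by split_ifs <;> omega) (by split_ifs <;> omega)]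
    rcases Nat.eq_zero_or_pos i with rfl | hi0 <;> rcases Nat.eq_zero_or_pos j with rfl | hj0
    · simp
    · rw [if_pos rfl, if_neg (by omega)]; omega
    · rw [if_pos rfl, if_neg (by omega)]; omega
    · rw [if_neg (by omega), if_neg (by omega)]; omega

variable {e : α × Bool → ℕ} {M : List ℕ} {n : ℕ} {G : SimpleGraph (FreeGroup α)}

theorem Hole.translate {q : ℕ} {F : ℕ → FreeGroup α} (hG : Good e M n G) (H : Hole G q F)
    (p : FreeGroup α) : Hole G q (fun k => p * F k) := by
  refine ⟨H.four, ?_, ?_⟩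
  · intro i j hi hj h
    exact H.inj i j hi hj (mul_left_cancel h)
  · intro i j hi hj
    rw [← H.adj i j hi hj, hG.inv]

theorem W_length (g : FreeGroup α) : (W e g).length = FreeGroup.norm g := by
  simp [W, FreeGroup.norm]

theorem W_inj (he : Function.Injective e) {g g' : FreeGroup α} (h : W e g = W e g') : g = g' :=
  FreeGroup.toWord_injective (List.map_injective_iff.2 he h)

theorem W_mul (s t : FreeGroup α) (h : gp s t = 0) : W e (s⁻¹ * t) = W e s⁻¹ ++ W e t := by
  simp [W, toWord_inv_mul' s t h, FreeGroup.toWord_inv]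

theorem W_take_gp (s t : FreeGroup α) (k : ℕ) (h : k ≤ gp s t) :
    (W e s).take k = (W e t).take k := by
  have := ((le_cpl_iff k _ _).1 h).2.2
  unfold W
  rw [← List.map_take, ← List.map_take, this]

theorem ne_of_dist {s t : FreeGroup α} (h : 0 < dist' s t) : s ≠ t := by
  intro h'
  rw [(dist'_eq_zero s t).2 h'] at h
  omega

/-- the crossing case -/
theorem crossing (hG : Good e M n G) (h : ℕ) (x y z w : FreeGroup α)
    (hx : x.norm = h) (hz : z.norm = h) (hy : y.norm + h = n) (hw : w.norm + h = n)
    (hh : 2 * h < n) (gxy : gp x y = 0) (gzy : gp z y = 0)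
    (gzw : gp z w = 0) (hyw : n ≤ 2 * (gp y w + h))
    (h1 : W e (y⁻¹ * x) < W e (z⁻¹ * y)) (h2 : W e (z⁻¹ * w) < W e (y⁻¹ * z)) : False := by
  have gyx : gp y x = 0 := by rw [gp_comm, gxy]
  have gyz : gp y z = 0 := by rw [gp_comm, gzy]
  have dyz := dist'_eq y z
  have dzy := dist'_eq z y
  have dyx := dist'_eq y x
  have dzw := dist'_eq z w
  set k := (n + 1) / 2 with hk
  have ny : (W e y⁻¹).length = y.norm := by rw [W_length, FreeGroup.norm_inv_eq]
  have nz : (W e z⁻¹).length = z.norm := by rw [W_length, FreeGroup.norm_inv_eq]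
  have e1 : (W e (y⁻¹ * x)).take k = (W e (y⁻¹ * z)).take k := by
    rw [W_mul y x gyx, W_mul y z gyz, List.take_append_of_le_length (by omega),
      List.take_append_of_le_length (by omega)]
  have e2 : (W e (z⁻¹ * y)).take k = (W e (z⁻¹ * w)).take k := by
    rw [W_mul z y gzy, W_mul z w gzw, List.take_append, List.take_append, nz,
      W_take_gp y w (k - z.norm) (by omega)]
  have f1 := lex_take k _ _ (by rw [W_length, W_length]; unfold dist' at *; omega) h1.le
  have f2 := lex_take k _ _ (by rw [W_length, W_length]; unfold dist' at *; omega) h2.le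
  rw [e1] at f1
  rw [← e2] at f2
  have f3 := le_antisymm f1 f2
  have f4 : (y⁻¹ * z).toWord.take k = ((y⁻¹ * z)⁻¹).toWord.take k := by
    have : (y⁻¹ * z)⁻¹ = z⁻¹ * y := by group
    rw [this]
    unfold W at f3
    rw [← List.map_take, ← List.map_take] at f3
    exact List.map_injective_iff.2 hG.inj f3
  have f5 := no_half (y⁻¹ * z) k (by unfold dist' at *; omega) f4
  have f6 : dist' y z = 0 := by unfold dist'; rw [f5]; simp
  omega

theorem four_lemma (hG : Good e M n G) (h : ℕ) (x y z w : FreeGroup α)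
    (hx : x.norm = h) (hz : z.norm = h) (hy : y.norm + h = n) (hw : w.norm + h = n)
    (hh : 2 * h < n) (gxy : gp x y = 0) (gxw : gp x w = 0) (gzy : gp z y = 0)
    (gzw : gp z w = 0) (hyw : n ≤ 2 * (gp y w + h))
    (axy : G.Adj x y) (azw : G.Adj z w) (axw : ¬ G.Adj x w) (azy : ¬ G.Adj z y) : False := by
  have dxy := dist'_eq x y
  have dxw := dist'_eq x w
  have dzy := dist'_eq z y
  have dzw := dist'_eq z w
  rw [hG.eq x y (ne_of_dist (by omega)) (by omega)] at axy
  rw [hG.eq z w (ne_of_dist (by omega)) (by omega)] at azw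
  rw [hG.eq x w (ne_of_dist (by omega)) (by omega)] at axw
  rw [hG.eq z y (ne_of_dist (by omega)) (by omega)] at azy
  push Not at axw azy
  have gwy : gp w y = gp y w := gp_comm _ _
  have gyx : gp y x = 0 := by rw [gp_comm, gxy]
  have gyz : gp y z = 0 := by rw [gp_comm, gzy]
  have gwx : gp w x = 0 := by rw [gp_comm, gxw]
  have gwz : gp w z = 0 := by rw [gp_comm, gzw]
  have nx : (W e x⁻¹).length = x.norm := by rw [W_length, FreeGroup.norm_inv_eq]
  have nz : (W e z⁻¹).length = z.norm := by rw [W_length, FreeGroup.norm_inv_eq]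
  rcases axy with a1 | a1 <;> rcases azw with a2 | a2
  · have b1 := a1.trans_lt azy.1
    have b2 := a2.trans_lt axw.1
    rw [W_mul x y gxy, W_mul z y gzy, lex_append _ _ _ _ (by omega)] at b1
    rw [W_mul x w gxw, W_mul z w gzw, lex_append _ _ _ _ (by omega)] at b2
    rcases b1 with b1 | b1
    · rcases b2 with b2 | b2
      · exact lt_asymm b1 b2
      · exact lt_irrefl _ b2.2
    · exact lt_irrefl _ b1.2
  · exact crossing hG h z w x y hz hx hw hy hh gzw gxw gxy (by omega) (a2.trans_lt axw.1)
      (a1.trans_lt axw.2)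
  · exact crossing hG h x y z w hx hz hy hw hh gxy gzy gzw (by omega) (a1.trans_lt azy.1)
      (a2.trans_lt azy.2)
  · have b1 := a1.trans_lt azy.2
    have b2 := a2.trans_lt axw.2
    rw [W_mul y x gyx, W_mul y z gyz, lex_append _ _ _ _ rfl] at b1
    rw [W_mul w z gwz, W_mul w x gwx, lex_append _ _ _ _ rfl] at b2
    rcases b1 with b1 | b1
    · exact lt_irrefl _ b1
    · rcases b2 with b2 | b2
      · exact lt_irrefl _ b2
      · exact lt_asymm b1.2 b2.2

/-- Chains of consecutive vertices sharing prefixes. -/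
theorem gp_chain (F : ℕ → FreeGroup α) (t : ℕ) (b : ℕ)
    (h : ∀ k, 1 ≤ k → k + 1 ≤ b → t ≤ gp (F k) (F (k + 1))) (h0 : t ≤ (F 1).norm) :
    ∀ k, 1 ≤ k → k ≤ b → t ≤ gp (F 1) (F k) := by
  intro k hk
  induction k, hk using Nat.le_induction with
  | base =>
    intro _
    have := dist'_eq (F 1) (F 1)
    rw [(dist'_eq_zero _ _).2 rfl] at this
    omega
  | succ k hk ih =>
    intro hb
    exact gp_ultra _ _ _ _ (ih (by omega)) (h k hk hb)

/-- Case of small `h`. -/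
theorem case_lt {q : ℕ} {F : ℕ → FreeGroup α} (hG : Good e M n G) (H : Hole G q F) (h : ℕ)
    (hh : 2 * h < n) (hx : (F 0).norm = h) (hz : (F (q - 1)).norm = h)
    (hy : (F 1).norm + h = n) (hw : (F (q - 2)).norm + h = n)
    (dxy : dist' (F 0) (F 1) = n) (dxw : dist' (F 0) (F (q - 2)) = n)
    (dzy : dist' (F (q - 1)) (F 1) = n) (dzw : dist' (F (q - 1)) (F (q - 2)) = n) : False := by
  have h4 := H.four
  have e1 := dist'_eq (F 0) (F 1)
  have e2 := dist'_eq (F 0) (F (q - 2))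
  have e3 := dist'_eq (F (q - 1)) (F 1)
  have e4 := dist'_eq (F (q - 1)) (F (q - 2))
  refine four_lemma hG h (F 0) (F 1) (F (q - 1)) (F (q - 2)) hx hz hy hw hh (by omega) (by omega)
    (by omega) (by omega) ?_ ?_ ?_ ?_ ?_
  · by_contra hcon
    have hn : ∀ k, 1 ≤ k → k ≤ q - 2 → n ≤ (F k).norm + h := by
      intro k h1 h2
      by_contra hc
      have := dist'_eq (F 0) (F k)
      have h3 := hG.lt (F 0) (F k) (fun h => by have := H.inj _ _ (by omega) (by omega) h; omega)
        (by omega)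
      rw [H.adj _ _ (by omega) (by omega)] at h3
      have : k = 1 := by omega
      subst this
      omega
    have := gp_chain F (gp (F 1) (F (q - 2)) + 1) (q - 2) (by
      intro k h1 h2
      have a1 := hG.le (F k) (F (k + 1)) ((H.adj _ _ (by omega) (by omega)).2 (by omega))
      have a2 := dist'_eq (F k) (F (k + 1))
      have a3 := hn k h1 (by omega)
      have a4 := hn (k + 1) (by omega) (by omega)
      omega) (by omega) (q - 2) (by omega) le_rfl
    omega
  · rw [H.adj _ _ (by omega) (by omega)]; omega
  · rw [H.adj _ _ (by omega) (by omega)]; omega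
  · rw [H.adj _ _ (by omega) (by omega)]; omega
  · rw [H.adj _ _ (by omega) (by omega)]; omega

/-- Facts about a sphere of radius `n/2`. -/
theorem sph_adj (hG : Good e M n G) (h : ℕ) (hh : 2 * h = n) (a b : FreeGroup α)
    (ha : a.norm = h) (hb : b.norm = h) (hab : a ≠ b) (hlt : W e a⁻¹ < M.take h) : G.Adj a b := by
  have d := dist'_eq a b
  by_cases hg : gp a b = 0
  · rw [hG.eq a b hab (by omega)]
    left
    apply le_of_lt
    have na : (W e a⁻¹).length = h := by rw [W_length, FreeGroup.norm_inv_eq, ha]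
    refine lex_of_take h _ _ (by rw [W_length, hG.len]; unfold dist' at d; omega) ?_
    rw [W_mul a b hg, List.take_append_of_le_length (by omega),
      List.take_of_length_le (by omega)]
    exact hlt
  · exact hG.lt a b hab (by omega)

theorem sph_of_adj (hG : Good e M n G) (h : ℕ) (hh : 2 * h = n) (a b : FreeGroup α)
    (ha : a.norm = h) (hb : b.norm = h) (hab : G.Adj a b) (hg : gp a b = 0) :
    W e a⁻¹ ≤ M.take h ∨ W e b⁻¹ ≤ M.take h := by
  have d := dist'_eq a b
  have d' := dist'_eq b a
  have hg' : gp b a = 0 := by rw [gp_comm, hg]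
  rw [hG.eq a b hab.ne (by omega)] at hab
  have na : (W e a⁻¹).length = h := by rw [W_length, FreeGroup.norm_inv_eq, ha]
  have nb : (W e b⁻¹).length = h := by rw [W_length, FreeGroup.norm_inv_eq, hb]
  rcases hab with hab | hab
  · left
    have := lex_take h _ _ (by rw [W_length, hG.len]; unfold dist' at d; omega) hab
    rwa [W_mul a b hg, List.take_append_of_le_length (by omega),
      List.take_of_length_le (by omega)] at this
  · right
    have := lex_take h _ _ (by rw [W_length, hG.len]; unfold dist' at d'; omega) hab
    rwa [W_mul b a hg', List.take_append_of_le_length (by omega),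
      List.take_of_length_le (by omega)] at this

/-- Case `h = n/2`. -/
theorem case_eq {q : ℕ} {F : ℕ → FreeGroup α} (hG : Good e M n G) (H : Hole G q F) (h : ℕ)
    (hh : 2 * h = n) (h0 : 0 < h) (hx : (F 0).norm = h) (hz : (F (q - 1)).norm = h)
    (hy : (F 1).norm = h) (gxy : gp (F 0) (F 1) = 0)
    (gxz : gp (F 0) (F (q - 1)) = 0) (gyz : gp (F 1) (F (q - 1)) = 0) : False := by
  have h4 := H.four
  have ne : ∀ i j, i < q → j < q → i ≠ j → F i ≠ F j := fun i j hi hj hij h =>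
    hij (H.inj i j hi hj h)
  have hn : ∀ k, 1 ≤ k → k ≤ q - 1 → h ≤ (F k).norm := by
    intro k h1 h2
    by_contra hc
    have := dist'_eq (F 0) (F k)
    have h3 := hG.lt (F 0) (F k) (ne _ _ (by omega) (by omega) (by omega)) (by omega)
    rw [H.adj _ _ (by omega) (by omega)] at h3
    rcases Nat.lt_or_ge k 2 with h5 | h5
    · have : k = 1 := by omega
      subst this; omega
    · have : k = q - 1 := by omega
      subst this; omega
  -- no vertex other than `x` is strictly below
  have noless : ∀ j, j < q → (F j).norm = h → W e (F j)⁻¹ < M.take h → j = 0 := by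
    intro j hj hjn hlt
    by_contra hj0
    have a0 := sph_adj hG h hh (F j) (F 0) hjn hx (ne _ _ hj (by omega) hj0) hlt
    rw [H.adj _ _ (by omega) (by omega)] at a0
    by_cases hj1 : j = 1
    · have a1 := sph_adj hG h hh (F j) (F (q - 1)) hjn hz (ne _ _ hj (by omega) (by omega)) hlt
      rw [H.adj _ _ (by omega) (by omega)] at a1
      omega
    · have a1 := sph_adj hG h hh (F j) (F 1) hjn hy (ne _ _ hj (by omega) (by omega)) hlt
      rw [H.adj _ _ (by omega) (by omega)] at a1
      omega
  have hxle : W e (F 0)⁻¹ ≤ M.take h := by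
    have a1 := sph_of_adj hG h hh (F 0) (F 1) hx hy
      ((H.adj _ _ (by omega) (by omega)).2 (by omega)) gxy
    have a2 := sph_of_adj hG h hh (F 0) (F (q - 1)) hx hz
      ((H.adj _ _ (by omega) (by omega)).2 (by omega)) gxz
    rcases a1 with a1 | a1
    · exact a1
    rcases a2 with a2 | a2
    · exact a2
    exfalso
    have b1 : W e (F 1)⁻¹ = M.take h := by
      refine a1.eq_of_not_lt fun hl => ?_
      have := noless 1 (by omega) hy hl
      omega
    have b2 : W e (F (q - 1))⁻¹ = M.take h := by
      refine a2.eq_of_not_lt fun hl => ?_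
      have := noless (q - 1) (by omega) hz hl
      omega
    exact ne 1 (q - 1) (by omega) (by omega) (by omega)
      (inv_injective (W_inj hG.inj (b1.trans b2.symm)))
  have := gp_chain F 1 (q - 1) (by
    intro k h1 h2
    by_contra hg
    have a1 := (H.adj k (k + 1) (by omega) (by omega)).2 (by omega)
    have a2 := hG.le _ _ a1
    have a3 := dist'_eq (F k) (F (k + 1))
    have a4 := hn k h1 (by omega)
    have a5 := hn (k + 1) (by omega) (by omega)
    rcases hxle.lt_or_eq with hl | he
    · have b1 := sph_adj hG h hh (F 0) (F k) hx (by omega) (ne _ _ (by omega) (by omega) (by omega))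
        hl
      have b2 := sph_adj hG h hh (F 0) (F (k + 1)) hx (by omega)
        (ne _ _ (by omega) (by omega) (by omega)) hl
      rw [H.adj _ _ (by omega) (by omega)] at b1 b2
      omega
    · have big : ∀ j, 1 ≤ j → j < q → (F j).norm = h → ¬ W e (F j)⁻¹ ≤ M.take h := by
        intro j hj1 hj2 hj3 hj4
        rcases hj4.lt_or_eq with hj4 | hj4
        · have := noless j hj2 hj3 hj4
          omega
        · exact ne j 0 (by omega) (by omega) (by omega)
            (inv_injective (W_inj hG.inj (hj4.trans he.symm)))
      rcases sph_of_adj hG h hh (F k) (F (k + 1)) (by omega) (by omega) a1 (by omega) with b | b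
      · exact big k (by omega) (by omega) (by omega) b
      · exact big (k + 1) (by omega) (by omega) (by omega) b) (by omega) (q - 1) (by omega) le_rfl
  omega

theorem gp_ultra3 (s t u : FreeGroup α) : gp s u ≥ min (gp s t) (gp t u) :=
  gp_ultra s t u _ (min_le_left _ _) (min_le_right _ _)

set_option maxHeartbeats 2000000 in
theorem no_hole_aux {q : ℕ} {F : ℕ → FreeGroup α} (hG : Good e M n G) (H : Hole G q F)
    (hmax : ∀ k, k < q → (F k).norm ≤ (F 0).norm)
    (hc : gp (F 0) (F 1) ≤ gp (F 1) (F (q - 1))) : False := by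
  have h4 := H.four
  have ne : ∀ i j, i < q → j < q → i ≠ j → F i ≠ F j := fun i j hi hj hij h =>
    hij (H.inj i j hi hj h)
  obtain ⟨x, hx⟩ : ∃ x, F 0 = x := ⟨_, rfl⟩
  obtain ⟨y, hy⟩ : ∃ x, F 1 = x := ⟨_, rfl⟩
  obtain ⟨z, hz⟩ : ∃ x, F (q - 1) = x := ⟨_, rfl⟩
  obtain ⟨w, hw⟩ : ∃ x, F (q - 2) = x := ⟨_, rfl⟩
  have axy : dist' x y ≤ n := by
    rw [← hx, ← hy]; exact hG.le _ _ ((H.adj _ _ (by omega) (by omega)).2 (by omega))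
  have axz : dist' x z ≤ n := by
    rw [← hx, ← hz]; exact hG.le _ _ ((H.adj _ _ (by omega) (by omega)).2 (by omega))
  have azw : dist' z w ≤ n := by
    rw [← hz, ← hw]; exact hG.le _ _ ((H.adj _ _ (by omega) (by omega)).2 (by omega))
  have nyz : n ≤ dist' y z := by
    by_contra hcon
    have := hG.lt (F 1) (F (q - 1)) (ne _ _ (by omega) (by omega) (by omega))
      (by rw [hy, hz]; omega)
    rw [H.adj _ _ (by omega) (by omega)] at this
    omega
  have nxw : n ≤ dist' x w := by
    by_contra hcon
    have := hG.lt (F 0) (F (q - 2)) (ne _ _ (by omega) (by omega) (by omega))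
      (by rw [hx, hw]; omega)
    rw [H.adj _ _ (by omega) (by omega)] at this
    omega
  have nexz : x ≠ z := by rw [← hx, ← hz]; exact ne _ _ (by omega) (by omega) (by omega)
  have my := hmax 1 (by omega)
  have mz := hmax (q - 1) (by omega)
  have mw := hmax (q - 2) (by omega)
  rw [hx, hy] at my
  rw [hx, hz] at mz
  rw [hx, hw] at mw
  rw [hx, hy, hz] at hc
  have dxy := dist'_eq x y
  have dxz := dist'_eq x z
  have dyz := dist'_eq y z
  have dxw := dist'_eq x w
  have dzw := dist'_eq z w
  have dzw := dist'_eq z w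
  have dpos : dist' x z ≠ 0 := fun h => nexz ((dist'_eq_zero _ _).1 h)
  have czx := gp_comm z x
  have czy := gp_comm z y
  have cyx := gp_comm y x
  have cwx := gp_comm w x
  have cwz := gp_comm w z
  have u1 := gp_ultra3 x y z
  have u2 := gp_ultra3 x z w
  have u3 := gp_ultra3 z x w
  have g1 := gp_le_left x z
  have g2 := gp_le_right x z
  have zn : z.norm = x.norm := by omega
  have dxy' : dist' x y = n := by omega
  have dyz' : dist' y z = n := by omega
  obtain ⟨c, hcdef⟩ : ∃ c, gp x z = c := ⟨_, rfl⟩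
  have g3 : c ≤ x.norm := hcdef ▸ g1
  have pn := norm_pre x c g3
  have ppx := gp_pre x x c g3
  have ppy := gp_pre x y c g3
  have ppz := gp_pre x z c g3
  have ppw := gp_pre x w c g3
  have dpx := dist'_eq (pre x c) x
  have dpy := dist'_eq (pre x c) y
  have dpz := dist'_eq (pre x c) z
  have dpw := dist'_eq (pre x c) w
  have dxx := dist'_eq x x
  rw [(dist'_eq_zero x x).2 rfl] at dxx
  have qx : dist' (pre x c) x = x.norm - c := by omega
  have qz : dist' (pre x c) z = x.norm - c := by omega
  have qy : dist' (pre x c) y + (x.norm - c) = n := by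
    have : min c (gp x y) = gp x y := by omega
    omega
  have qpos : 0 < x.norm - c := by omega
  have qw : 2 * (x.norm - c) < n → dist' (pre x c) w + (x.norm - c) = n ∧ dist' x w = n ∧
      dist' z w = n := by
    intro hlt
    have hle : gp z w ≤ c := by omega
    have hle' : gp x w ≤ c := by omega
    have : min c (gp x w) = gp x w := by omega
    omega
  have qc : dist' x z = 2 * (x.norm - c) := by omega
  have qzy := dist'_comm z y
  clear dpx dpy dpz dpw dxx ppx ppy ppz ppw u1 u2 u3 czx czy cyx cwx cwz dxy dxz dyz dxw dzw
  clear g1 g2 g3 pn hc my mz mw hcdef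
  set p := pre x c with hp
  have H' := H.translate hG p⁻¹
  have nrm : ∀ s, (p⁻¹ * s).norm = dist' p s := fun s => rfl
  rcases Nat.lt_or_ge (2 * (x.norm - c)) n with hlt | hge
  · obtain ⟨w1, w2, w3⟩ := qw hlt
    refine case_lt hG H' (x.norm - c) hlt ?_ ?_ ?_ ?_ ?_ ?_ ?_ ?_ <;>
      simp only [nrm, dist'_left, hx, hy, hz, hw] <;> omega
  · have t1 := dist'_eq (p⁻¹ * x) (p⁻¹ * y)
    have t2 := dist'_eq (p⁻¹ * x) (p⁻¹ * z)
    have t3 := dist'_eq (p⁻¹ * y) (p⁻¹ * z)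
    simp only [nrm, dist'_left] at t1 t2 t3
    refine case_eq hG H' (x.norm - c) (by omega) (by omega) ?_ ?_ ?_ ?_ ?_ ?_ <;>
      simp only [nrm, hx, hy, hz] <;> omega

theorem no_hole {q : ℕ} {F : ℕ → FreeGroup α} (hG : Good e M n G) (H : Hole G q F) : False := by
  have h4 := H.four
  obtain ⟨a, ha, hmax⟩ := Finset.exists_max_image (Finset.range q) (fun k => (F k).norm)
    ⟨0, by simp; omega⟩
  simp only [Finset.mem_range] at ha hmax
  have H1 := H.rotate a ha
  set F1 := (fun k => F (if k + a < q then k + a else k + a - q)) with hF1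
  have hm1 : ∀ k, k < q → (F1 k).norm ≤ (F1 0).norm := by
    intro k hk
    have e0 : F1 0 = F a := by simp [hF1, ha]
    rw [e0]
    exact hmax _ (by split_ifs <;> omega)
  clear_value F1
  by_cases hc : gp (F1 0) (F1 1) ≤ gp (F1 1) (F1 (q - 1))
  · exact no_hole_aux hG H1 hm1 hc
  · refine no_hole_aux hG H1.reflect ?_ ?_
    · intro k hk
      simpa using hm1 _ (by split_ifs <;> omega)
    · have e1 : q - (q - 1) = 1 := by omega
      have e2 : q - 1 ≠ 0 := by omega
      simp only [if_true, one_ne_zero, if_false, e1, e2]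
      have u := gp_ultra3 (F1 1) (F1 0) (F1 (q - 1))
      have c1 := gp_comm (F1 1) (F1 0)
      have c2 := gp_comm (F1 1) (F1 (q - 1))
      omega

end Core

section Final

variable {m : ℕ}

open Classical in
/-- rank of a letter -/
noncomputable def rank (lt : FreeGroup (Fin m) → FreeGroup (Fin m) → Prop) (a : Fin m × Bool) : ℕ :=
  (Finset.univ.filter (fun b : Fin m × Bool => lt (FreeGroup.mk [b]) (FreeGroup.mk [a]))).card

theorem mk_inj (a b : Fin m × Bool) (h : FreeGroup.mk [a] = FreeGroup.mk [b]) : a = b := by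
  have := congrArg FreeGroup.toWord h
  simpa [FreeGroup.toWord_mk, FreeGroup.reduce_singleton] using this

variable {lt : FreeGroup (Fin m) → FreeGroup (Fin m) → Prop}

theorem rank_lt (hlt : IsLexOrder lt) {a b : Fin m × Bool}
    (h : lt (FreeGroup.mk [a]) (FreeGroup.mk [b])) : rank lt a < rank lt b := by
  have := hlt.1
  apply Finset.card_lt_card
  rw [Finset.ssubset_iff_of_subset]
  · refine ⟨a, by simpa using h, ?_⟩
    simpa using irrefl_of lt _
  · intro c hc
    simp only [Finset.mem_filter, Finset.mem_univ, true_and] at *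
    exact trans_of lt hc h

theorem rank_inj (hlt : IsLexOrder lt) : Function.Injective (rank lt) := by
  have := hlt.1
  intro a b h
  rcases trichotomous_of lt (FreeGroup.mk [a]) (FreeGroup.mk [b]) with h1 | h1 | h1
  · have := rank_lt hlt h1; omega
  · exact mk_inj _ _ h1
  · have := rank_lt hlt h1; omega

theorem lt_imp_W (hlt : IsLexOrder lt) {s t : FreeGroup (Fin m)} (hn : s.norm = t.norm)
    (h : lt s t) : W (rank lt) s < W (rank lt) t := by
  have := hlt.1
  have hne : s ≠ t := by rintro rfl; exact irrefl_of lt _ h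
  obtain ⟨P, A, B, h1, h2, h3, h4⟩ := cpl_decomp s.toWord t.toWord
  have hlen : A.length = B.length := by
    unfold FreeGroup.norm at hn
    rw [h1, h2] at hn
    simpa using hn
  rcases A with _ | ⟨a, A⟩
  · have : B = [] := by simpa using hlen.symm
    subst this
    exact absurd (FreeGroup.toWord_injective (h1.trans h2.symm)) hne
  rcases B with _ | ⟨b, B⟩
  · simp at hlen
  have := (hlt.2.2 s t hn hne a b (by rw [h3, h1]; simp) (by rw [h3, h2]; simp)).1 h
  have := rank_lt hlt this
  unfold W
  rw [h1, h2, List.map_append, List.map_append, lex_append _ _ _ _ rfl]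
  right
  refine ⟨rfl, ?_⟩
  rw [List.map_cons, List.map_cons, List.cons_lt_cons_iff]
  exact Or.inl this

theorem le_iff_W (hlt : IsLexOrder lt) {s t : FreeGroup (Fin m)} (hn : s.norm = t.norm) :
    (lt s t ∨ s = t) ↔ W (rank lt) s ≤ W (rank lt) t := by
  have := hlt.1
  constructor
  · rintro (h | rfl)
    · exact (lt_imp_W hlt hn h).le
    · exact le_rfl
  · intro h
    rcases trichotomous_of lt s t with h1 | h1 | h1
    · exact Or.inl h1
    · exact Or.inr h1
    · exact absurd (lt_imp_W hlt hn.symm h1) (not_lt.2 h)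

theorem exists_min (hlt : IsLexOrder lt) (ν : FreeGroup (Fin m)) :
    ∃ μ : FreeGroup (Fin m), ∀ x, hatLe lt x ν ↔ ((lt x μ ∨ x = μ) ∨ (lt x⁻¹ μ ∨ x⁻¹ = μ)) := by
  have := hlt.1
  have tr : ∀ a b c : FreeGroup (Fin m), lt b c → (lt a b ∨ a = b) → (lt a c ∨ a = c) := by
    rintro a b c h (h1 | rfl)
    · exact Or.inl (trans_of lt h1 h)
    · exact Or.inl h
  unfold hatLe
  rcases trichotomous_of lt ν ν⁻¹ with h | h | h
  · refine ⟨ν, fun x => ⟨fun h' => h'.1, fun h' => ⟨h', ?_⟩⟩⟩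
    exact h'.imp (tr _ _ _ h) (tr _ _ _ h)
  · refine ⟨ν, fun x => ?_⟩
    rw [← h]
    exact and_self_iff
  · refine ⟨ν⁻¹, fun x => ⟨fun h' => h'.2, fun h' => ⟨?_, h'⟩⟩⟩
    exact h'.imp (tr _ _ _ h) (tr _ _ _ h)

theorem good_Gamma (hlt : IsLexOrder lt) (ν : FreeGroup (Fin m)) :
    ∃ M n, Good (rank lt) M n (Gamma lt ν) := by
  have := hlt.1
  obtain ⟨μ, hμ⟩ := exists_min hlt ν
  have hadj : ∀ s t, (Gamma lt ν).Adj s t ↔ s ≠ t ∧ ((lt (s⁻¹ * t) μ ∨ s⁻¹ * t = μ) ∨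
      (lt (t⁻¹ * s) μ ∨ t⁻¹ * s = μ)) := by
    intro s t
    have e : t⁻¹ * s = (s⁻¹ * t)⁻¹ := by group
    rw [e, ← hμ]
    rfl
  have hle : ∀ x, (lt x μ ∨ x = μ) → x.norm ≤ μ.norm := by
    rintro x (h | rfl)
    · by_contra hc
      exact irrefl_of lt _ (trans_of lt h (hlt.2.1 μ x (by omega)))
    · exact le_rfl
  refine ⟨W (rank lt) μ, μ.norm, rank_inj hlt, W_length _, ?_, ?_, ?_, ?_⟩
  · intro s t h
    rcases ((hadj s t).1 h).2 with h | h
    · exact hle _ h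
    · rw [dist'_comm]; exact hle _ h
  · intro s t hne h
    exact (hadj s t).2 ⟨hne, Or.inl (Or.inl (hlt.2.1 _ _ h))⟩
  · intro s t hne h
    rw [hadj, le_iff_W hlt h, le_iff_W hlt (by rw [dist'_comm] at h; exact h)]
    simp [hne]
  · intro p s t
    have e : ∀ a b : FreeGroup (Fin m), (p * a)⁻¹ * (p * b) = a⁻¹ * b := by intro a b; group
    rw [hadj, hadj, e, e]
    simp

theorem hole_of_cycle {V : Type*} {G : SimpleGraph V} {v : V} (w : G.Walk v v) (hw : w.IsCycle)
    (h4 : 4 ≤ w.length) (hc : ¬ w.HasChord) : Hole G w.length w.getVert := by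
  have hinj : ∀ i j, i < w.length → j < w.length → w.getVert i = w.getVert j → i = j := by
    intro i j hi hj h
    exact hw.getVert_injOn' (by simp; omega) (by simp; omega) h
  have hlast : w.getVert w.length = w.getVert 0 := by simp
  refine ⟨h4, hinj, ?_⟩
  intro i j hi hj
  constructor
  · intro h
    have hmem : s(w.getVert i, w.getVert j) ∈ w.edges := by
      by_contra hcon
      exact hc ⟨_, _, w.getVert_mem_support i, w.getVert_mem_support j, h, hcon⟩
    obtain ⟨d, hd, hde⟩ := List.mem_map.1 hmem
    obtain ⟨k, hk, rfl⟩ := List.getElem_of_mem hd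
    have hk' : k < w.length := by simpa using hk
    have key : s(w.getVert k, w.getVert (k + 1)) = s(w.getVert i, w.getVert j) := by
      rw [← hde, SimpleGraph.Walk.darts_getElem_eq_getVert]
      rfl
    have step : ∀ a, a < w.length → w.getVert (k + 1) = w.getVert a →
        a = k + 1 ∨ (a = 0 ∧ k + 1 = w.length) := by
      intro a ha h
      by_cases hkl : k + 1 < w.length
      · left; exact (hinj _ _ hkl ha h).symm
      · have e : k + 1 = w.length := by omega
        rw [e, hlast] at h
        have := hinj _ _ (by omega) ha h
        right; omega
    rw [Sym2.eq_iff] at key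
    rcases key with ⟨h1, h2⟩ | ⟨h1, h2⟩
    · have := hinj _ _ hk' hi h1
      have := step j hj h2
      omega
    · have := hinj _ _ hk' hj h1
      have := step i hi h2
      omega
  · have adj : ∀ a, a < w.length → G.Adj (w.getVert a) (w.getVert (a + 1)) :=
      fun a ha => w.adj_getVert_succ ha
    rintro (rfl | rfl | ⟨rfl, h⟩ | ⟨rfl, h⟩)
    · exact adj _ hi
    · exact (adj _ hj).symm
    · have := adj j hj
      rw [h, hlast] at this
      exact this.symm
    · have := adj i hi
      rw [h, hlast] at this
      exact this

end Final

/-- For any lexicographic order `≼` on `Fₘ` (`m ≥ 1`) and any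
`ν ∈ F̂`, the graph `Γ_ν` is chordal. -/
theorem gamma_isChordal {m : ℕ} (hm : 1 ≤ m)
    (lt : FreeGroup (Fin m) → FreeGroup (Fin m) → Prop) (hlt : IsLexOrder lt)
    (ν : FreeGroup (Fin m)) : (Gamma lt ν).IsChordalGraph := by
  intro v w hw h4
  by_contra hc
  obtain ⟨M, n, hG⟩ := good_Gamma hlt ν
  exact no_hole hG (hole_of_cycle w hw h4 hc)

end FreeGroupLex
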